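/- The only rational solutions (x, y) of the equation y² = -2x⁶ + 5x³ - 2 are (x, y) = (1, 1) and (1, -1). -/

import Mathlib

/-- A domain with a natural-valued size function admitting division with remainder is a principal
ideal ring. -/
theorem isPrincipalIdealRing_of_exists_sub_mul_lt {A : Type*} [CommRing A] (N : A → ℕ)
    (h : ∀ a b : A, b ≠ 0 → ∃ q, N (a - b * q) < N b) : IsPrincipalIdealRing A := by
  refine ⟨fun I => ?_⟩
  by_cases hI : I = ⊥
  · exact hI ▸ ⟨0, by simp⟩
  obtain ⟨c, hcI, hc0⟩ := Submodule.exists_mem_ne_zero_of_ne_bot hI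
  obtain ⟨b, ⟨hbI, hb0⟩, hmin⟩ :=
    (measure N).wf.has_min {b | b ∈ I ∧ b ≠ 0} ⟨c, hcI, hc0⟩
  refine ⟨b, le_antisymm (fun a ha => ?_) ((Ideal.span_singleton_le_iff_mem I).2 hbI)⟩
  obtain ⟨q, hq⟩ := h a b hb0
  have hz : a - b * q = 0 := by
    by_contra hne
    exact hmin _ ⟨I.sub_mem ha (I.mul_mem_right q hbI), hne⟩ hq
  exact Ideal.mem_span_singleton.2 ⟨q, sub_eq_zero.1 hz⟩

/-- The ring `ℤ[√-2]`. -/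
abbrev ZSqrtNegTwo := QuadraticAlgebra ℤ (-2) 0

namespace ZSqrtNegTwo

theorem norm_eq (z : ZSqrtNegTwo) : z.norm = z.re ^ 2 + 2 * z.im ^ 2 := by
  rw [QuadraticAlgebra.norm_def]; ring

theorem norm_nonneg (z : ZSqrtNegTwo) : 0 ≤ z.norm := by
  rw [norm_eq]; positivity

theorem norm_eq_zero {z : ZSqrtNegTwo} : z.norm = 0 ↔ z = 0 := by
  refine ⟨fun h => ?_, fun h => by simp [h]⟩
  rw [norm_eq] at h
  ext
  · exact pow_eq_zero_iff two_ne_zero |>.1 (by nlinarith [sq_nonneg z.re, sq_nonneg z.im])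
  · exact pow_eq_zero_iff two_ne_zero |>.1 (by nlinarith [sq_nonneg z.re, sq_nonneg z.im])

instance : NoZeroDivisors ZSqrtNegTwo where
  eq_zero_or_eq_zero_of_mul_eq_zero {a b} h := by
    have := congrArg QuadraticAlgebra.norm h
    rw [map_mul, QuadraticAlgebra.norm_zero, mul_eq_zero, norm_eq_zero, norm_eq_zero] at this
    exact this

instance : IsDomain ZSqrtNegTwo := NoZeroDivisors.to_isDomain _

theorem norm_pos {z : ZSqrtNegTwo} (h : z ≠ 0) : 0 < z.norm :=
  (norm_nonneg z).lt_of_ne fun h' => h (norm_eq_zero.1 h'.symm)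

theorem exists_abs_two_mul_sub_le (t : ℤ) {n : ℤ} (hn : 0 < n) :
    ∃ q, |2 * (t - n * q)| ≤ n := by
  have h1 := Int.emod_add_mul_ediv t n
  have h2 := Int.emod_nonneg t hn.ne'
  have h3 := Int.emod_lt_of_pos t hn
  rcases le_total (2 * (t % n)) n with h | h
  · exact ⟨t / n, by rw [abs_le]; constructor <;> linarith⟩
  · exact ⟨t / n + 1, by rw [abs_le]; constructor <;> linarith⟩

instance : IsPrincipalIdealRing ZSqrtNegTwo := by
  refine isPrincipalIdealRing_of_exists_sub_mul_lt (fun z => z.norm.natAbs) fun a b hb => ?_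
  have hn := norm_pos hb
  obtain ⟨q₁, h₁⟩ := exists_abs_two_mul_sub_le (a * star b).re hn
  obtain ⟨q₂, h₂⟩ := exists_abs_two_mul_sub_le (a * star b).im hn
  refine ⟨⟨q₁, q₂⟩, ?_⟩
  zify
  rw [abs_of_nonneg (norm_nonneg _), abs_of_nonneg hn.le]
  have key : (a - b * ⟨q₁, q₂⟩).norm * b.norm =
      ((a * star b).re - b.norm * q₁) ^ 2 + 2 * ((a * star b).im - b.norm * q₂) ^ 2 := by
    simp only [norm_eq, QuadraticAlgebra.re_mul, QuadraticAlgebra.im_mul, QuadraticAlgebra.re_sub,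
      QuadraticAlgebra.im_sub, QuadraticAlgebra.re_star, QuadraticAlgebra.im_star]
    ring
  have s₁ := sq_le_sq' (abs_le.1 h₁).1 (abs_le.1 h₁).2
  have s₂ := sq_le_sq' (abs_le.1 h₂).1 (abs_le.1 h₂).2
  nlinarith

theorem isUnit_iff {z : ZSqrtNegTwo} : IsUnit z ↔ z = 1 ∨ z = -1 := by
  refine ⟨fun h => ?_, by rintro (rfl | rfl); exacts [isUnit_one, isUnit_one.neg]⟩
  have h1 := Int.isUnit_iff.1 (QuadraticAlgebra.isUnit_iff_norm_isUnit.1 h)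
  have h2 := norm_nonneg z
  rw [norm_eq] at h1 h2
  have hi : z.im = 0 := by
    by_contra h0
    have : 0 < z.im ^ 2 := by positivity
    rcases h1 with h1 | h1 <;> nlinarith [sq_nonneg z.re]
  rw [hi] at h1
  have hr : z.re = 1 ∨ z.re = -1 := by
    refine sq_eq_one_iff.1 ?_
    rcases h1 with h1 | h1 <;> nlinarith [sq_nonneg z.re]
  rcases hr with hr | hr
  · left; ext <;> simp [hr, hi, QuadraticAlgebra.re_one, QuadraticAlgebra.im_one]
  · right; ext <;> simp [hr, hi, QuadraticAlgebra.re_one, QuadraticAlgebra.im_one]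

/-- Coprime factors of a cube in `ℤ[√-2]` are cubes, as all units are. -/
theorem exists_eq_pow_three {a b c : ZSqrtNegTwo} (hab : IsCoprime a b) (h : a * b = c ^ 3) :
    ∃ d, a = d ^ 3 := by
  obtain ⟨d, u, hu⟩ := exists_associated_pow_of_mul_eq_pow' hab h
  rcases isUnit_iff.1 u.isUnit with h1 | h1
  · exact ⟨d, by rw [← hu, h1, mul_one]⟩
  · exact ⟨-d, by rw [← hu, h1]; ring⟩

end ZSqrtNegTwo

open QuadraticAlgebra

/-- The ring `ℤ[√-2, ω]`, where `ω` is a primitive cube root of unity. -/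
abbrev ZSqrtNegTwoOmega := QuadraticAlgebra ZSqrtNegTwo (-1) (-1)

namespace ZSqrtNegTwoOmega

theorem relNorm_eq (z : ZSqrtNegTwoOmega) :
    z.norm = z.re ^ 2 - z.re * z.im + z.im ^ 2 := by
  rw [norm_def]; ring

/-- The absolute norm on `ℤ[√-2, ω]`. -/
def absNorm : ZSqrtNegTwoOmega →* ℤ :=
  (QuadraticAlgebra.norm : ZSqrtNegTwo →* ℤ).comp QuadraticAlgebra.norm

/-- The form giving the absolute norm of `(x₁ + x₂ω) + (y₁ + y₂ω)√-2`. -/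
def normForm (x₁ x₂ y₁ y₂ : ℤ) : ℤ :=
  ((x₁ ^ 2 - x₁ * x₂ + x₂ ^ 2) - 2 * (y₁ ^ 2 - y₁ * y₂ + y₂ ^ 2)) ^ 2 +
    2 * (2 * x₁ * y₁ + 2 * x₂ * y₂ - x₁ * y₂ - x₂ * y₁) ^ 2

theorem absNorm_eq (z : ZSqrtNegTwoOmega) :
    absNorm z = normForm z.re.re z.im.re z.re.im z.im.im := by
  simp only [absNorm, MonoidHom.comp_apply, relNorm_eq, ZSqrtNegTwo.norm_eq, normForm, sq, re_add,
    im_add, re_sub, im_sub, re_mul, im_mul]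
  ring

theorem normForm_nonneg (x₁ x₂ y₁ y₂ : ℤ) : 0 ≤ normForm x₁ x₂ y₁ y₂ := by
  unfold normForm; positivity

theorem eisensteinForm_eq_zero {x y : ℤ} (h : x ^ 2 - x * y + y ^ 2 = 0) : x = 0 ∧ y = 0 := by
  have hy : y ^ 2 = 0 := by nlinarith [sq_nonneg (2 * x - y), sq_nonneg y]
  have hx : x ^ 2 = 0 := by nlinarith [sq_nonneg (2 * y - x), sq_nonneg x]
  exact ⟨pow_eq_zero_iff two_ne_zero |>.1 hx, pow_eq_zero_iff two_ne_zero |>.1 hy⟩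

theorem normForm_eq_zero {x₁ x₂ y₁ y₂ : ℤ} (h : normForm x₁ x₂ y₁ y₂ = 0) :
    (x₁ = 0 ∧ x₂ = 0) ∧ y₁ = 0 ∧ y₂ = 0 := by
  have hid : (2 * x₁ * y₁ + 2 * x₂ * y₂ - x₁ * y₂ - x₂ * y₁) ^ 2 + 3 * (x₁ * y₂ - x₂ * y₁) ^ 2 =
      4 * ((x₁ ^ 2 - x₁ * x₂ + x₂ ^ 2) * (y₁ ^ 2 - y₁ * y₂ + y₂ ^ 2)) := by ring
  unfold normForm at h
  have hY : y₁ ^ 2 - y₁ * y₂ + y₂ ^ 2 = 0 := by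
    set X := x₁ ^ 2 - x₁ * x₂ + x₂ ^ 2
    set Y := y₁ ^ 2 - y₁ * y₂ + y₂ ^ 2
    set T := 2 * x₁ * y₁ + 2 * x₂ * y₂ - x₁ * y₂ - x₂ * y₁
    have h1 : X - 2 * Y = 0 := pow_eq_zero_iff two_ne_zero |>.1 (by
      nlinarith [sq_nonneg (X - 2 * Y), sq_nonneg T])
    have h2 : T ^ 2 = 0 := by nlinarith [sq_nonneg (X - 2 * Y), sq_nonneg T]
    by_contra hY
    have hsq : IsSquare ((24 : ℤ) : ℚ) := by
      refine ⟨3 * (x₁ * y₂ - x₂ * y₁ : ℤ) / Y, ?_⟩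
      have hYQ : (Y : ℚ) ≠ 0 := by exact_mod_cast hY
      field_simp
      norm_cast
      linear_combination (-3) * hid + 3 * h2 - 12 * Y * h1
    rw [Rat.isSquare_intCast_iff] at hsq
    obtain ⟨r, hr⟩ := hsq
    have h3 : r ≤ 4 := by nlinarith
    have h4 : -4 ≤ r := by nlinarith
    interval_cases r <;> omega
  obtain ⟨rfl, rfl⟩ := eisensteinForm_eq_zero hY
  refine ⟨eisensteinForm_eq_zero (pow_eq_zero_iff two_ne_zero |>.1 ?_), rfl, rfl⟩
  linear_combination h

theorem absNorm_eq_zero {z : ZSqrtNegTwoOmega} : absNorm z = 0 ↔ z = 0 := by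
  refine ⟨fun h => ?_, fun h => by simp [h, absNorm]⟩
  rw [absNorm_eq] at h
  obtain ⟨⟨h1, h2⟩, h3, h4⟩ := normForm_eq_zero h
  ext <;> simpa

instance : NoZeroDivisors ZSqrtNegTwoOmega where
  eq_zero_or_eq_zero_of_mul_eq_zero {a b} h := by
    have := congrArg absNorm h
    rwa [map_mul, absNorm_eq_zero.2 rfl, mul_eq_zero, absNorm_eq_zero, absNorm_eq_zero] at this

instance : IsDomain ZSqrtNegTwoOmega := NoZeroDivisors.to_isDomain _

theorem absNorm_nonneg (z : ZSqrtNegTwoOmega) : 0 ≤ absNorm z := by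
  rw [absNorm_eq]; exact normForm_nonneg _ _ _ _

theorem absNorm_pos {z : ZSqrtNegTwoOmega} (h : z ≠ 0) : 0 < absNorm z :=
  (absNorm_nonneg z).lt_of_ne fun h' => h (absNorm_eq_zero.1 h'.symm)

/-- In an equilateral triangle of side `n` with vertices `0`, `n`, `n + nω`, every point other than
the centre is at squared distance less than `n ^ 2 / 3` from some vertex. -/
theorem exists_eisensteinForm_lt_aux {n x y : ℤ} (hn : 0 < n) (hy : 0 ≤ y) (hxy : y ≤ x)
    (hx : x ≤ n) :
    (∃ p q, 3 * ((x - n * p) ^ 2 - (x - n * p) * (y - n * q) + (y - n * q) ^ 2) < n ^ 2) ∨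
      (3 * x = 2 * n ∧ 3 * y = n) := by
  by_contra! hc
  obtain ⟨h, hne⟩ := hc
  have h0 := h 0 0
  have h1 := h 1 0
  have h2 := h 1 1
  have key : n * n ^ 2 ≤ n * (3 * (n * x - (x ^ 2 - x * y + y ^ 2))) := by
    have a0 := mul_nonneg (sub_nonneg.2 hx) (sub_nonneg.2 h0)
    have a1 := mul_nonneg (sub_nonneg.2 hxy) (sub_nonneg.2 h1)
    have a2 := mul_nonneg hy (sub_nonneg.2 h2)
    linarith
  have key := le_of_mul_le_mul_left key hn
  have e1 : (3 * x - 2 * n) ^ 2 = 0 := by nlinarith [sq_nonneg (2 * y - x), sq_nonneg (3 * x - 2 * n)]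
  have e2 : (2 * y - x) ^ 2 = 0 := by nlinarith [sq_nonneg (2 * y - x), sq_nonneg (3 * x - 2 * n)]
  have e1 := pow_eq_zero_iff two_ne_zero |>.1 e1
  have e2 := pow_eq_zero_iff two_ne_zero |>.1 e2
  exact hne (by linarith) (by linarith)

theorem exists_eisensteinForm_lt {n : ℤ} (hn : 0 < n) (x y : ℤ) :
    (∃ p q, 3 * ((x - n * p) ^ 2 - (x - n * p) * (y - n * q) + (y - n * q) ^ 2) < n ^ 2) ∨
      ∃ p q, (3 * (x - n * p) = 2 * n ∧ 3 * (y - n * q) = n) ∨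
        (3 * (x - n * p) = n ∧ 3 * (y - n * q) = 2 * n) := by
  have hx1 := Int.emod_add_mul_ediv x n
  have hx2 := Int.emod_nonneg x hn.ne'
  have hx3 := (Int.emod_lt_of_pos x hn).le
  have hy1 := Int.emod_add_mul_ediv y n
  have hy2 := Int.emod_nonneg y hn.ne'
  have hy3 := (Int.emod_lt_of_pos y hn).le
  rcases le_total (y % n) (x % n) with h | h
  · rcases exists_eisensteinForm_lt_aux hn hy2 h hx3 with ⟨p, q, h⟩ | ⟨h1, h2⟩
    · left
      refine ⟨x / n + p, y / n + q, ?_⟩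
      have e1 : x - n * (x / n + p) = x % n - n * p := by linarith
      have e2 : y - n * (y / n + q) = y % n - n * q := by linarith
      rwa [e1, e2]
    · exact Or.inr ⟨x / n, y / n, Or.inl ⟨by linarith, by linarith⟩⟩
  · rcases exists_eisensteinForm_lt_aux hn hx2 h hy3 with ⟨p, q, h⟩ | ⟨h1, h2⟩
    · left
      refine ⟨x / n + q, y / n + p, ?_⟩
      have e1 : x - n * (x / n + q) = x % n - n * q := by linarith
      have e2 : y - n * (y / n + p) = y % n - n * p := by linarith
      rw [e1, e2]
      linarith
    · exact Or.inr ⟨x / n, y / n, Or.inr ⟨by linarith, by linarith⟩⟩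

theorem normForm_lt {n x₁ x₂ y₁ y₂ : ℤ} (hx : 3 * (x₁ ^ 2 - x₁ * x₂ + x₂ ^ 2) ≤ n ^ 2)
    (hy : 3 * (y₁ ^ 2 - y₁ * y₂ + y₂ ^ 2) ≤ n ^ 2)
    (h : 3 * (x₁ ^ 2 - x₁ * x₂ + x₂ ^ 2) < n ^ 2 ∨ 3 * (y₁ ^ 2 - y₁ * y₂ + y₂ ^ 2) < n ^ 2) :
    normForm x₁ x₂ y₁ y₂ < n ^ 4 := by
  have hX : 0 ≤ x₁ ^ 2 - x₁ * x₂ + x₂ ^ 2 := by nlinarith [sq_nonneg (2 * x₁ - x₂), sq_nonneg x₂]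
  have hY : 0 ≤ y₁ ^ 2 - y₁ * y₂ + y₂ ^ 2 := by nlinarith [sq_nonneg (2 * y₁ - y₂), sq_nonneg y₂]
  have hCS : (2 * x₁ * y₁ + 2 * x₂ * y₂ - x₁ * y₂ - x₂ * y₁) ^ 2 ≤
      4 * ((x₁ ^ 2 - x₁ * x₂ + x₂ ^ 2) * (y₁ ^ 2 - y₁ * y₂ + y₂ ^ 2)) := by
    nlinarith [sq_nonneg (x₁ * y₂ - x₂ * y₁)]
  unfold normForm
  generalize x₁ ^ 2 - x₁ * x₂ + x₂ ^ 2 = X at *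
  generalize y₁ ^ 2 - y₁ * y₂ + y₂ ^ 2 = Y at *
  have h1 : 3 * (X + 2 * Y) < 3 * n ^ 2 := by rcases h with h | h <;> linarith
  have h2 : (X + 2 * Y) ^ 2 < (n ^ 2) ^ 2 := by
    apply pow_lt_pow_left₀ (by linarith) (by positivity) two_ne_zero
  nlinarith

theorem exists_normForm_lt {n : ℤ} (hn : 0 < n) (x₁ x₂ y₁ y₂ : ℤ) : ∃ p₁ p₂ q₁ q₂,
    normForm (x₁ - n * p₁) (x₂ - n * p₂) (y₁ - n * q₁) (y₂ - n * q₂) < n ^ 4 := by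
  have hx := exists_eisensteinForm_lt hn x₁ x₂
  have hy := exists_eisensteinForm_lt hn y₁ y₂
  have aux : ∀ u v : ℤ, (3 * u = 2 * n ∧ 3 * v = n) ∨ (3 * u = n ∧ 3 * v = 2 * n) →
      3 * (u ^ 2 - u * v + v ^ 2) ≤ n ^ 2 := by
    rintro u v (⟨h1, h2⟩ | ⟨h1, h2⟩) <;> nlinarith
  rcases hx with ⟨p₁, p₂, hx⟩ | ⟨p₁, p₂, hx⟩ <;> rcases hy with ⟨q₁, q₂, hy⟩ | ⟨q₁, q₂, hy⟩
  · exact ⟨p₁, p₂, q₁, q₂, normForm_lt hx.le hy.le (Or.inl hx)⟩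
  · exact ⟨p₁, p₂, q₁, q₂, normForm_lt hx.le (aux _ _ hy) (Or.inl hx)⟩
  · exact ⟨p₁, p₂, q₁, q₂, normForm_lt (aux _ _ hx) hy.le (Or.inr hy)⟩
  · obtain ⟨m, rfl⟩ : ∃ m, n = 3 * m := by
      rcases hx with h | h
      exacts [⟨_, h.2.symm⟩, ⟨_, h.1.symm⟩]
    have hm : 0 < m ^ 4 := pow_pos (by linarith) 4
    have shift : ∀ u p : ℤ, u - 3 * m * (p + 1) = u - 3 * m * p - 3 * m := fun u p => by ring
    rcases hx with ⟨h1, h2⟩ | ⟨h1, h2⟩ <;> rcases hy with ⟨h3, h4⟩ | ⟨h3, h4⟩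
    · refine ⟨p₁, p₂, q₁ + 1, q₂, ?_⟩
      rw [shift, show x₁ - 3 * m * p₁ = 2 * m by linarith, show x₂ - 3 * m * p₂ = m by linarith,
        show y₁ - 3 * m * q₁ = 2 * m by linarith, show y₂ - 3 * m * q₂ = m by linarith]
      unfold normForm; linarith
    · refine ⟨p₁, p₂, q₁, q₂ + 1, ?_⟩
      rw [shift, show x₁ - 3 * m * p₁ = 2 * m by linarith, show x₂ - 3 * m * p₂ = m by linarith,
        show y₁ - 3 * m * q₁ = m by linarith, show y₂ - 3 * m * q₂ = 2 * m by linarith]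
      unfold normForm; linarith
    · refine ⟨p₁, p₂, q₁ + 1, q₂, ?_⟩
      rw [shift, show x₁ - 3 * m * p₁ = m by linarith, show x₂ - 3 * m * p₂ = 2 * m by linarith,
        show y₁ - 3 * m * q₁ = 2 * m by linarith, show y₂ - 3 * m * q₂ = m by linarith]
      unfold normForm; linarith
    · refine ⟨p₁, p₂, q₁, q₂ + 1, ?_⟩
      rw [shift, show x₁ - 3 * m * p₁ = m by linarith, show x₂ - 3 * m * p₂ = 2 * m by linarith,
        show y₁ - 3 * m * q₁ = m by linarith, show y₂ - 3 * m * q₂ = 2 * m by linarith]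
      unfold normForm; linarith

instance : IsPrincipalIdealRing ZSqrtNegTwoOmega := by
  refine isPrincipalIdealRing_of_exists_sub_mul_lt (fun z => (absNorm z).natAbs) fun a b hb => ?_
  have hn := absNorm_pos hb
  set n := absNorm b with hndef
  let c : ZSqrtNegTwoOmega := star b * algebraMap _ _ (star (norm b))
  have hbc : b * c = (n : ZSqrtNegTwoOmega) := by
    have h1 := algebraMap_norm_eq_mul_star b
    have h2 := algebraMap_norm_eq_mul_star (norm b)
    rw [← mul_assoc, ← h1, ← map_mul, ← h2]
    rfl
  have hint : ∀ m : ℤ, absNorm (m : ZSqrtNegTwoOmega) = m ^ 4 := fun m => by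
    simp [absNorm]; ring
  have hc : absNorm c = n ^ 3 := by
    have := congrArg absNorm hbc
    rw [map_mul, hint, ← hndef] at this
    exact mul_left_cancel₀ hn.ne' (by rw [this]; ring)
  obtain ⟨p₁, p₂, q₁, q₂, h⟩ :=
    exists_normForm_lt hn (a * c).re.re (a * c).im.re (a * c).re.im (a * c).im.im
  refine ⟨⟨⟨p₁, q₁⟩, ⟨p₂, q₂⟩⟩, ?_⟩
  zify
  rw [abs_of_nonneg (absNorm_nonneg _), abs_of_nonneg hn.le]
  have key : absNorm ((a - b * ⟨⟨p₁, q₁⟩, ⟨p₂, q₂⟩⟩) * c) < n ^ 4 := by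
    have : (a - b * ⟨⟨p₁, q₁⟩, ⟨p₂, q₂⟩⟩) * c =
        a * c - (n : ZSqrtNegTwoOmega) * ⟨⟨p₁, q₁⟩, ⟨p₂, q₂⟩⟩ := by rw [← hbc]; ring
    rw [this, absNorm_eq]
    convert h using 2 <;> simp
  rw [map_mul, hc] at key
  exact lt_of_mul_lt_mul_right (by linarith) (pow_pos hn 3).le

/-- The primitive cube root of unity in `ℤ[√-2, ω]`. -/
abbrev ζ : ZSqrtNegTwoOmega := ⟨0, 1⟩

/-- The fundamental unit `√-2 + √-3` of `ℤ[√-2, ω]`. -/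
abbrev ε : ZSqrtNegTwoOmega := ⟨⟨1, 1⟩, 2⟩

theorem ε_mul : ε * ⟨⟨-1, 1⟩, -2⟩ = 1 := by
  ext <;> simp

theorem absNorm_eq_one_of_isUnit {u : ZSqrtNegTwoOmega} (hu : IsUnit u) : absNorm u = 1 := by
  rcases Int.isUnit_iff.1 (hu.map absNorm) with h | h
  · exact h
  · linarith [absNorm_nonneg u]

theorem exists_eq_of_eisensteinForm_eq_one {x y : ℤ} (h : x ^ 2 - x * y + y ^ 2 = 1) :
    (x = 1 ∧ y = 0) ∨ (x = -1 ∧ y = 0) ∨ (x = 0 ∧ y = 1) ∨ (x = 0 ∧ y = -1) ∨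
      (x = 1 ∧ y = 1) ∨ (x = -1 ∧ y = -1) := by
  have hx : x ≤ 1 ∧ -1 ≤ x := by constructor <;> nlinarith [sq_nonneg (2 * y - x)]
  have hy : y ≤ 1 ∧ -1 ≤ y := by constructor <;> nlinarith [sq_nonneg (2 * x - y)]
  obtain ⟨hx1, hx2⟩ := hx
  obtain ⟨hy1, hy2⟩ := hy
  interval_cases x <;> interval_cases y <;> simp_all

theorem exists_eq_ζ_pow_mul_ε_pow_mul_cube_of_norm (n : ℕ) : ∀ u : ZSqrtNegTwoOmega,
    absNorm u = 1 → (u.re.re ^ 2 - u.re.re * u.im.re + u.im.re ^ 2) +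
      2 * (u.re.im ^ 2 - u.re.im * u.im.im + u.im.im ^ 2) ≤ n →
    ∃ i j : ℕ, ∃ w, u = ζ ^ i * ε ^ j * w ^ 3 := by
  induction n with
  | zero =>
    intro u hu h
    have : u.re.re ^ 2 - u.re.re * u.im.re + u.im.re ^ 2 = 0 ∧
        u.re.im ^ 2 - u.re.im * u.im.im + u.im.im ^ 2 = 0 := by
      have h1 : 0 ≤ u.re.re ^ 2 - u.re.re * u.im.re + u.im.re ^ 2 := by
        nlinarith [sq_nonneg (2 * u.re.re - u.im.re), sq_nonneg u.im.re]
      have h2 : 0 ≤ u.re.im ^ 2 - u.re.im * u.im.im + u.im.im ^ 2 := by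
        nlinarith [sq_nonneg (2 * u.re.im - u.im.im), sq_nonneg u.im.im]
      constructor <;> push_cast at h <;> linarith
    obtain ⟨h1, h2⟩ := eisensteinForm_eq_zero this.1
    obtain ⟨h3, h4⟩ := eisensteinForm_eq_zero this.2
    simp [absNorm_eq, normForm, h1, h2, h3, h4] at hu
  | succ n ih =>
    intro u hu h
    have hpell : ((u.re.re ^ 2 - u.re.re * u.im.re + u.im.re ^ 2) +
        2 * (u.re.im ^ 2 - u.re.im * u.im.im + u.im.im ^ 2)) ^ 2 -
        6 * (u.re.re * u.im.im - u.im.re * u.re.im) ^ 2 = 1 := by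
      rw [absNorm_eq] at hu
      rw [← hu, normForm]; ring
    have hU : 0 ≤ (u.re.re ^ 2 - u.re.re * u.im.re + u.im.re ^ 2) +
        2 * (u.re.im ^ 2 - u.re.im * u.im.im + u.im.im ^ 2) := by
      nlinarith [sq_nonneg (2 * u.re.re - u.im.re), sq_nonneg u.im.re,
        sq_nonneg (2 * u.re.im - u.im.im), sq_nonneg u.im.im]
    have hε : absNorm ε = 1 := absNorm_eq_one_of_isUnit (IsUnit.of_mul_eq_one _ ε_mul)
    have hε' : absNorm (⟨⟨-1, 1⟩, -2⟩ : ZSqrtNegTwoOmega) = 1 :=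
      absNorm_eq_one_of_isUnit (IsUnit.of_mul_eq_one_right _ ε_mul)
    rcases lt_trichotomy (u.re.re * u.im.im - u.im.re * u.re.im) 0 with hV | hV | hV
    · obtain ⟨i, j, w, hw⟩ := ih (⟨⟨-1, 1⟩, -2⟩ * u) (by rw [map_mul, hε', hu, mul_one]) (by
        push_cast at h
        simp
        nlinarith)
      refine ⟨i, j + 1, w, ?_⟩
      calc u = ε * ⟨⟨-1, 1⟩, -2⟩ * u := by rw [ε_mul, one_mul]
        _ = _ := by rw [mul_assoc, hw]; ring
    · have h1 : (u.re.re ^ 2 - u.re.re * u.im.re + u.im.re ^ 2) +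
        2 * (u.re.im ^ 2 - u.re.im * u.im.im + u.im.im ^ 2) = 1 := by
        rw [hV] at hpell; nlinarith
      have h2 : u.re.im ^ 2 - u.re.im * u.im.im + u.im.im ^ 2 = 0 := by
        have h3 : 0 ≤ u.re.re ^ 2 - u.re.re * u.im.re + u.im.re ^ 2 := by
          nlinarith [sq_nonneg (2 * u.re.re - u.im.re), sq_nonneg u.im.re]
        have h4 : 0 ≤ u.re.im ^ 2 - u.re.im * u.im.im + u.im.im ^ 2 := by
          nlinarith [sq_nonneg (2 * u.re.im - u.im.im), sq_nonneg u.im.im]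
        linarith
      rw [h2, mul_zero, add_zero] at h1
      obtain ⟨h3, h4⟩ := eisensteinForm_eq_zero h2
      have hu' : u = ⟨⟨u.re.re, u.re.im⟩, ⟨u.im.re, u.im.im⟩⟩ := rfl
      rcases exists_eq_of_eisensteinForm_eq_one h1 with h | h | h | h | h | h <;>
        rw [hu', h3, h4, h.1, h.2]
      · exact ⟨0, 0, 1, by ext <;> simp⟩
      · exact ⟨0, 0, -1, by ext <;> simp [pow_succ]⟩
      · exact ⟨1, 0, 1, by ext <;> simp⟩
      · exact ⟨1, 0, -1, by ext <;> simp [pow_succ]⟩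
      · exact ⟨2, 0, -1, by ext <;> simp [pow_succ]⟩
      · exact ⟨2, 0, 1, by ext <;> simp [pow_succ]⟩
    · obtain ⟨i, j, w, hw⟩ := ih (ε * u) (by rw [map_mul, hε, hu, mul_one]) (by
        push_cast at h
        simp
        nlinarith)
      refine ⟨i, j + 2, ⟨⟨-1, 1⟩, -2⟩ * w, ?_⟩
      have h3 : ε ^ 3 * (⟨⟨-1, 1⟩, -2⟩ : ZSqrtNegTwoOmega) ^ 3 = 1 := by
        rw [← mul_pow, ε_mul, one_pow]
      calc u = ⟨⟨-1, 1⟩, -2⟩ * (ε * u) := by rw [← mul_assoc, mul_comm _ ε, ε_mul, one_mul]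
        _ = ε ^ 3 * (⟨⟨-1, 1⟩, -2⟩ : ZSqrtNegTwoOmega) ^ 3 *
            (⟨⟨-1, 1⟩, -2⟩ * (ζ ^ i * ε ^ j * w ^ 3)) := by rw [hw, h3, one_mul]
        _ = ε * ⟨⟨-1, 1⟩, -2⟩ * (ζ ^ i * ε ^ (j + 2) * (⟨⟨-1, 1⟩, -2⟩ * w) ^ 3) := by ring
        _ = _ := by rw [ε_mul, one_mul]

/-- The units of `ℤ[√-2, ω]` are generated modulo cubes by `ζ` and `ε`. -/
theorem exists_eq_ζ_pow_mul_ε_pow_mul_cube {u : ZSqrtNegTwoOmega} (hu : IsUnit u) :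
    ∃ i < 3, ∃ j < 3, ∃ w, u = ζ ^ i * ε ^ j * w ^ 3 := by
  obtain ⟨i, j, w, rfl⟩ := exists_eq_ζ_pow_mul_ε_pow_mul_cube_of_norm _ u
    (absNorm_eq_one_of_isUnit hu) (Int.self_le_toNat _)
  refine ⟨i % 3, Nat.mod_lt _ (by simp), j % 3, Nat.mod_lt _ (by simp),
    ζ ^ (i / 3) * ε ^ (j / 3) * w, ?_⟩
  conv_lhs => rw [← Nat.mod_add_div i 3, ← Nat.mod_add_div j 3]
  ring

end ZSqrtNegTwoOmega

namespace ZSqrtNegTwo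

/-- The square root of `-2` in `ℤ[√-2]`. -/
abbrev σ : ZSqrtNegTwo := ⟨0, 1⟩

/-- The prime `1 + √-2` above `3`. -/
abbrev π₁ : ZSqrtNegTwo := ⟨1, 1⟩

/-- The prime `1 - √-2` above `3`. -/
abbrev π₂ : ZSqrtNegTwo := ⟨1, -1⟩

theorem σ_sq : σ ^ 2 = -2 := by
  ext <;> simp [pow_succ]

theorem π₁_mul_π₂ : π₁ * π₂ = 3 := by
  ext <;> simp

theorem π₁_dvd_iff {z : ZSqrtNegTwo} : π₁ ∣ z ↔ 3 ∣ z.re - z.im := by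
  constructor
  · rintro ⟨w, rfl⟩
    exact ⟨-w.im, by simp; ring⟩
  · rintro ⟨k, hk⟩
    exact ⟨⟨k + z.im, -k⟩, by ext <;> simp; linarith⟩

theorem π₂_dvd_iff {z : ZSqrtNegTwo} : π₂ ∣ z ↔ 3 ∣ z.re + z.im := by
  constructor
  · rintro ⟨w, rfl⟩
    exact ⟨w.im, by simp; ring⟩
  · rintro ⟨k, hk⟩
    exact ⟨⟨k - z.im, k⟩, by ext <;> simp; linarith⟩

theorem prime_π₁ : Prime π₁ := by
  refine ⟨fun h => by simpa using congrArg re h, fun h => ?_, fun a b h => ?_⟩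
  · rcases isUnit_iff.1 h with h | h <;> simpa using congrArg im h
  · rw [π₁_dvd_iff] at h
    simp only [π₁_dvd_iff]
    refine Int.Prime.dvd_mul' Nat.prime_three ?_
    have : (a.re - a.im) * (b.re - b.im) = ((a * b).re - (a * b).im) + 3 * (a.im * b.im) := by
      simp; ring
    rw [this]
    exact dvd_add h (dvd_mul_right _ _)

theorem prime_π₂ : Prime π₂ := by
  refine ⟨fun h => by simpa using congrArg re h, fun h => ?_, fun a b h => ?_⟩
  · rcases isUnit_iff.1 h with h | h <;> simpa using congrArg im h
  · rw [π₂_dvd_iff] at h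
    simp only [π₂_dvd_iff]
    refine Int.Prime.dvd_mul' Nat.prime_three ?_
    have : (a.re + a.im) * (b.re + b.im) = ((a * b).re + (a * b).im) + 3 * (a.im * b.im) := by
      simp; ring
    rw [this]
    exact dvd_add h (dvd_mul_right _ _)

theorem isCoprime_π₁ {z : ZSqrtNegTwo} (h : ¬π₁ ∣ z) : IsCoprime π₁ z :=
  prime_π₁.irreducible.coprime_iff_not_dvd.2 h

theorem isCoprime_π₂ {z : ZSqrtNegTwo} (h : ¬π₂ ∣ z) : IsCoprime π₂ z :=
  prime_π₂.irreducible.coprime_iff_not_dvd.2 h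

theorem isCoprime_π₁_π₂ : IsCoprime π₁ π₂ :=
  isCoprime_π₁ (by rw [π₁_dvd_iff]; decide)

theorem isCoprime_three {z : ZSqrtNegTwo} (h₁ : ¬π₁ ∣ z) (h₂ : ¬π₂ ∣ z) : IsCoprime 3 z := by
  rw [← π₁_mul_π₂]
  exact (isCoprime_π₁ h₁).mul_left (isCoprime_π₂ h₂)

theorem three_dvd {z : ZSqrtNegTwo} (h₁ : π₁ ∣ z) (h₂ : π₂ ∣ z) : 3 ∣ z := by
  rw [← π₁_mul_π₂]
  exact isCoprime_π₁_π₂.mul_dvd h₁ h₂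

/-- Reduction modulo `π₁ ^ 2`. -/
def modπ₁Sq : ZSqrtNegTwo →+* ZMod 9 where
  toFun z := z.re + 5 * z.im
  map_zero' := by simp
  map_one' := by simp
  map_add' a b := by simp; ring
  map_mul' a b := by
    have h9 : (-9 : ZMod 9) = 0 := by decide
    simp
    linear_combination (3 * (a.im : ZMod 9) * b.im) * h9

/-- Reduction modulo `π₂ ^ 2`. -/
def modπ₂Sq : ZSqrtNegTwo →+* ZMod 9 where
  toFun z := z.re + 4 * z.im
  map_zero' := by simp
  map_one' := by simp
  map_add' a b := by simp; ring
  map_mul' a b := by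
    have h9 : (-9 : ZMod 9) = 0 := by decide
    simp
    linear_combination (2 * (a.im : ZMod 9) * b.im) * h9

theorem modπ₁Sq_apply (z : ZSqrtNegTwo) : modπ₁Sq z = z.re + 5 * z.im := rfl

theorem modπ₂Sq_apply (z : ZSqrtNegTwo) : modπ₂Sq z = z.re + 4 * z.im := rfl

theorem three_mul_modπ₁Sq_eq_zero {z : ZSqrtNegTwo} : 3 * modπ₁Sq z = 0 ↔ π₁ ∣ z := by
  rw [π₁_dvd_iff, modπ₁Sq_apply]
  have : (3 * (z.re + 5 * z.im) : ZMod 9) = ((3 * (z.re + 5 * z.im) : ℤ) : ZMod 9) := by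
    push_cast; rfl
  rw [this, ZMod.intCast_zmod_eq_zero_iff_dvd]
  push_cast
  omega

theorem three_mul_modπ₂Sq_eq_zero {z : ZSqrtNegTwo} : 3 * modπ₂Sq z = 0 ↔ π₂ ∣ z := by
  rw [π₂_dvd_iff, modπ₂Sq_apply]
  have : (3 * (z.re + 4 * z.im) : ZMod 9) = ((3 * (z.re + 4 * z.im) : ℤ) : ZMod 9) := by
    push_cast; rfl
  rw [this, ZMod.intCast_zmod_eq_zero_iff_dvd]
  push_cast
  omega

theorem pow_three_injective {a b : ZSqrtNegTwo} (h : a ^ 3 = b ^ 3) : a = b := by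
  have h1 : (a - b) * (a ^ 2 + a * b + b ^ 2) = 0 := by linear_combination h
  rcases mul_eq_zero.1 h1 with h1 | h1
  · exact sub_eq_zero.1 h1
  · have h2 : (⟨a, -b⟩ : ZSqrtNegTwoOmega) * ⟨a + b, b⟩ = 0 := by
      ext1
      · simp; linear_combination h1
      · simp; ring
    rcases mul_eq_zero.1 h2 with h2 | h2
    · have h3 := congrArg re h2
      have h4 := congrArg im h2
      simp at h3 h4
      rw [h3, h4]
    · have h3 := congrArg re h2
      have h4 := congrArg im h2
      simp at h3 h4
      simpa [h4] using h3

end ZSqrtNegTwo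

namespace ZSqrtNegTwoOmega

open ZSqrtNegTwo

theorem eq_zero_of_modπ₂Sq {i j : ℕ} (hi : i < 3) (hj : j < 3) (γ : ZSqrtNegTwoOmega)
    (him : modπ₂Sq (ζ ^ i * ε ^ j * γ ^ 3).im = 0)
    (hre : 3 * modπ₂Sq (ζ ^ i * ε ^ j * γ ^ 3).re ≠ 0) : i = 0 ∧ j = 0 := by
  have hε : modπ₂Sq ⟨1, 1⟩ = 5 := by rw [modπ₂Sq_apply]; decide
  interval_cases i <;> interval_cases j <;>
    simp [pow_succ, hε] at him hre ⊢ <;>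
    generalize modπ₂Sq γ.re = a at him hre <;>
    generalize modπ₂Sq γ.im = b at him hre <;>
    revert a b <;> decide

end ZSqrtNegTwoOmega

namespace ZSqrtNegTwo

/-- If the coprime factors of `M = X ^ 2 + X * Y + Y ^ 2 = (X - ζ * Y) * (X - ζ ^ 2 * Y)` are cubes
up to units, with `X - Y = 3 * f` and `π₂ ^ 2 ∣ f`, then they are cubes. -/
theorem exists_eq_of_eq_pow_three {Y f ν : ZSqrtNegTwo}
    (hM : Y ^ 2 + 3 * f * Y + 3 * f ^ 2 = ν ^ 3) (hf : IsCoprime (3 * f) ν) (hf₂ : π₂ ^ 2 ∣ f) :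
    ∃ g h, f = 3 * (g * h * (g - h)) ∧ ν = g ^ 2 - g * h + h ^ 2 := by
  let κ : ZSqrtNegTwoOmega := ⟨Y + 2 * f, f⟩
  let C : ZSqrtNegTwo →+* ZSqrtNegTwoOmega := algebraMap _ _
  have hC : ∀ z, C z = ⟨z, 0⟩ := fun z => rfl
  have hκ : κ * star κ = C ν ^ 3 := by
    rw [← map_pow, ← hM, hC]
    ext1 <;> simp [κ] <;> ring
  have hcop : IsCoprime (κ - star κ) (C ν ^ 3) := by
    have h1 : IsCoprime (C (3 * f)) (C ν) := hf.map C
    refine IsCoprime.of_isCoprime_of_dvd_left h1.pow_right ⟨⟨-1, -2⟩, ?_⟩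
    rw [hC]
    ext1 <;> simp [κ] <;> ring
  have hcop : IsCoprime κ (star κ) := by
    rw [← hκ] at hcop
    obtain ⟨a, b, hab⟩ := hcop
    exact ⟨a, b * κ - a, by rw [← hab]; ring⟩
  obtain ⟨γ, u, hu⟩ := exists_associated_pow_of_mul_eq_pow' hcop hκ
  obtain ⟨i, hi, j, hj, w, hw⟩ := ZSqrtNegTwoOmega.exists_eq_ζ_pow_mul_ε_pow_mul_cube u.isUnit
  have hΓ : κ = ZSqrtNegTwoOmega.ζ ^ i * ZSqrtNegTwoOmega.ε ^ j * (w * γ) ^ 3 := by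
    rw [← hu, hw]; ring
  have him : modπ₂Sq κ.im = 0 := by
    obtain ⟨t, ht⟩ := hf₂
    have : modπ₂Sq (π₂ ^ 2) = 0 := by rw [modπ₂Sq_apply]; decide
    simp [κ, ht, -map_pow, this]
  have hre : 3 * modπ₂Sq κ.re ≠ 0 := by
    rw [Ne, three_mul_modπ₂Sq_eq_zero]
    have hf₃ : π₂ ∣ f := (dvd_pow_self _ two_ne_zero).trans hf₂
    intro h
    have hY : π₂ ∣ Y := (dvd_add_left (hf₃.mul_left 2)).1 h
    have hν : π₂ ∣ ν := prime_π₂.dvd_of_dvd_pow (n := 3) (by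
      rw [← hM]
      exact dvd_add (dvd_add (dvd_pow hY two_ne_zero) (hY.mul_left _))
        ((dvd_pow hf₃ two_ne_zero).mul_left _))
    exact prime_π₂.not_isUnit (hf.isUnit_of_dvd' (hf₃.mul_left 3) hν)
  obtain ⟨rfl, rfl⟩ := ZSqrtNegTwoOmega.eq_zero_of_modπ₂Sq hi hj (w * γ) (hΓ ▸ him) (hΓ ▸ hre)
  generalize w * γ = Γ at hΓ
  rw [pow_zero, pow_zero, one_mul, one_mul] at hΓ
  refine ⟨Γ.re, Γ.im, ?_, pow_three_injective ?_⟩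
  · have := congrArg im hΓ
    simp [κ, pow_succ] at this
    rw [this]; ring
  · rw [← hM]
    have h1 := congrArg im hΓ
    have h2 := congrArg re hΓ
    simp [κ, pow_succ] at h1 h2
    have h3 : Y ^ 2 + 3 * f * Y + 3 * f ^ 2 = (Y + 2 * f) ^ 2 - (Y + 2 * f) * f + f ^ 2 := by ring
    rw [h3, h2, h1]
    ring

theorem isCoprime_sub_left {X Y : ZSqrtNegTwo} (h : IsCoprime X Y) : IsCoprime (X - Y) Y := by
  simpa [sub_eq_add_neg] using h.add_mul_left_left (-1)

theorem isCoprime_sub_right {X Y : ZSqrtNegTwo} (h : IsCoprime X Y) : IsCoprime X (X - Y) := by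
  have := (h.add_mul_left_right (-1)).neg_right
  rwa [show -(Y + X * -1) = X - Y by ring] at this

/-- One step of a descent on `X ^ 3 - Y ^ 3 = π₂ ^ 2 * Z ^ 3`. -/
theorem descent_step {X Y D : ZSqrtNegTwo} (h : X ^ 3 - Y ^ 3 = π₂ ^ 2 * (3 * D) ^ 3)
    (hXY : IsCoprime X Y) : ∃ g h δ, IsCoprime g h ∧ g * h * (g - h) = π₂ ^ 2 * δ ^ 3 ∧
      δ * (g ^ 2 - g * h + h ^ 2) = D ∧ IsCoprime 3 (g ^ 2 - g * h + h ^ 2) := by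
  have hdvd : ∀ p : ZSqrtNegTwo, Prime p → p ∣ 3 → p ∣ X - Y := fun p hp h3 =>
    hp.dvd_of_dvd_pow (n := 3) (by
      have : (X - Y) ^ 3 = π₂ ^ 2 * (3 * D) ^ 3 - 3 * ((X - Y) * X * Y) := by rw [← h]; ring
      rw [this]
      exact dvd_sub ((dvd_pow (h3.mul_right _) three_ne_zero).mul_left _) (h3.mul_right _))
  have h₁ : π₁ ∣ 3 := ⟨π₂, π₁_mul_π₂.symm⟩
  have h₂ : π₂ ∣ 3 := ⟨π₁, by rw [mul_comm, π₁_mul_π₂]⟩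
  obtain ⟨f, hf⟩ := three_dvd (hdvd _ prime_π₁ h₁) (hdvd _ prime_π₂ h₂)
  obtain rfl : X = Y + 3 * f := by linear_combination hf
  set M := Y ^ 2 + 3 * f * Y + 3 * f ^ 2 with hM
  have h3 : (3 : ZSqrtNegTwo) ≠ 0 := fun h => by simpa using congrArg re h
  have hfM : f * M = 3 * π₂ ^ 2 * D ^ 3 := by
    apply mul_left_cancel₀ (pow_ne_zero 2 h3)
    rw [hM]
    linear_combination h
  have hYf : IsCoprime (3 * f) Y := by simpa [add_sub_cancel_left] using isCoprime_sub_left hXY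
  have hM3 : IsCoprime (3 * f) M := by
    have := hYf.pow_right (n := 2)
    have := this.add_mul_left_right (Y + f)
    rwa [show Y ^ 2 + 3 * f * (Y + f) = M by rw [hM]; ring] at this
  have h3M : IsCoprime 3 M := hM3.of_mul_left_left
  have hπM : IsCoprime (3 * π₂ ^ 2) M :=
    h3M.mul_left (IsCoprime.pow_left (h3M.of_isCoprime_of_dvd_left h₂))
  obtain ⟨f', hf'⟩ : 3 * π₂ ^ 2 ∣ f := hπM.dvd_of_dvd_mul_right ⟨D ^ 3, hfM⟩
  have h3π : 3 * π₂ ^ 2 ≠ 0 := mul_ne_zero h3 (pow_ne_zero 2 prime_π₂.ne_zero)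
  have hf'M : f' * M = D ^ 3 := mul_left_cancel₀ h3π (by rw [← hfM, hf']; ring)
  have hcop : IsCoprime f' M := by
    rw [hf'] at hM3
    exact hM3.of_mul_left_right.of_mul_left_right
  obtain ⟨δ, hδ⟩ := exists_eq_pow_three hcop hf'M
  obtain ⟨ν, hν⟩ := exists_eq_pow_three hcop.symm (by rw [mul_comm]; exact hf'M)
  have hfν : IsCoprime (3 * f) ν := by
    rw [hν] at hM3
    exact (IsCoprime.pow_right_iff three_pos).1 hM3
  obtain ⟨g, h, hg, rfl⟩ := exists_eq_of_eq_pow_three hν hfν ⟨3 * f', by rw [hf']; ring⟩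
  refine ⟨g, h, δ, ?_, ?_, ?_, hfν.of_mul_left_left⟩
  · rw [hg] at hfν
    have := hfν.of_mul_left_right.of_mul_left_right.of_mul_left_left.of_mul_left_left
    have := this.add_mul_left_right (h - g)
    rw [show g ^ 2 - g * h + h ^ 2 + g * (h - g) = h ^ 2 by ring] at this
    exact (IsCoprime.pow_right_iff two_pos).1 this
  · apply mul_left_cancel₀ h3
    rw [← hg, hf', hδ]; ring
  · apply pow_three_injective
    rw [mul_pow, ← hδ, ← hν, hf'M]

theorem π₁_dvd_of_sub_eq {X Y W : ZSqrtNegTwo} (h : X ^ 3 - Y ^ 3 = π₂ ^ 2 * W ^ 3)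
    (hν : ¬π₁ ∣ (X ^ 3) ^ 2 - X ^ 3 * (π₂ ^ 2 * W ^ 3) + (π₂ ^ 2 * W ^ 3) ^ 2) : π₁ ∣ W := by
  rw [← three_mul_modπ₁Sq_eq_zero] at hν ⊢
  have h := congrArg modπ₁Sq h
  have hπ : modπ₁Sq π₂ = 5 := by rw [modπ₁Sq_apply]; decide
  have hcube : ∀ a : ZMod 9, a ^ 3 = 0 ∧ 3 * a = 0 ∨ a ^ 3 = 1 ∨ a ^ 3 = -1 := by decide
  simp only [map_sub, map_add, map_mul, map_pow, hπ] at h hν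
  generalize modπ₁Sq X = a at h hν
  generalize modπ₁Sq Y = b at h
  generalize modπ₁Sq W = c at h hν ⊢
  rcases hcube a with ⟨ha, -⟩ | ha | ha <;> rcases hcube b with ⟨hb, -⟩ | hb | hb <;>
    rcases hcube c with ⟨hc, hc'⟩ | hc | hc <;> simp only [ha, hb, hc] at h hν <;>
    first | exact hc' | exact absurd h (by decide) | exact absurd (by decide) hν

/-- One of the three symmetric cases of the descent. -/
theorem descent_aux {n : ℕ} {g h δ : ZSqrtNegTwo} (hgh : IsCoprime g h)
    (H : g * h * (g - h) = π₂ ^ 2 * δ ^ 3) (hν : ¬π₁ ∣ g ^ 2 - g * h + h ^ 2)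
    (hδ : 3 ^ n ∣ δ) (hδ' : ¬π₁ ^ (n + 1) ∣ δ) (hh : π₂ ∣ h) :
    ∃ m, n = m + 1 ∧ ∃ X Y Z, X ^ 3 - Y ^ 3 = π₂ ^ 2 * Z ^ 3 ∧ IsCoprime X Y ∧ 3 ^ (m + 1) ∣ Z ∧
      ¬π₁ ^ (m + 2) ∣ Z := by
  have hgs : IsCoprime (g - h) h := isCoprime_sub_left hgh
  have hgs' : IsCoprime g (g - h) := isCoprime_sub_right hgh
  have h₁ : ¬π₂ ∣ g * (g - h) := fun h1 =>
    prime_π₂.not_isUnit ((hgh.mul_left hgs).isUnit_of_dvd' h1 hh)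
  obtain ⟨h', rfl⟩ : π₂ ^ 2 ∣ h :=
    (isCoprime_π₂ h₁).pow_left.dvd_of_dvd_mul_left ⟨δ ^ 3, by rw [← H]; ring⟩
  have H' : g * h' * (g - π₂ ^ 2 * h') = δ ^ 3 :=
    mul_left_cancel₀ (pow_ne_zero 2 prime_π₂.ne_zero) (by rw [← H]; ring)
  have hgh' := hgh.of_mul_right_right
  have hgs'' := hgs.of_mul_right_right
  obtain ⟨X, rfl⟩ := exists_eq_pow_three (hgh'.mul_right hgs') (by rw [← H']; ring)
  obtain ⟨W, rfl⟩ := exists_eq_pow_three (hgh'.symm.mul_right hgs''.symm)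
    (c := δ) (by rw [← H']; ring)
  obtain ⟨Y, hY⟩ := exists_eq_pow_three (hgs'.symm.mul_right hgs'') (c := δ) (by rw [← H']; ring)
  have hδe : X * Y * W = δ := pow_three_injective (by rw [← H', hY]; ring)
  have hXYW : X ^ 3 - Y ^ 3 = π₂ ^ 2 * W ^ 3 := by rw [← hY]; ring
  have hXY : IsCoprime X Y := by
    rw [hY] at hgs'
    exact (IsCoprime.pow_iff three_pos three_pos).1 hgs'
  have hW := π₁_dvd_of_sub_eq hXYW hν
  have key : ∀ p : ZSqrtNegTwo, Prime p → p ∣ π₂ ^ 2 * W ^ 3 → ¬p ∣ X ∧ ¬p ∣ Y := by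
    intro p hp hpd
    have h1 : p ∣ X ↔ p ∣ Y := by
      rw [← hp.dvd_pow_iff_dvd three_ne_zero, ← hp.dvd_pow_iff_dvd (a := Y) three_ne_zero]
      rw [← hXYW] at hpd
      exact (dvd_iff_dvd_of_dvd_sub hpd)
    have h2 : ¬p ∣ X := fun h2 => hp.not_isUnit (hXY.isUnit_of_dvd' h2 (h1.1 h2))
    exact ⟨h2, fun h3 => h2 (h1.2 h3)⟩
  obtain ⟨hX₁, hY₁⟩ := key _ prime_π₁ ((dvd_pow hW three_ne_zero).mul_left _)
  obtain ⟨hX₂, hY₂⟩ := key _ prime_π₂ ((dvd_pow_self _ two_ne_zero).mul_right _)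
  have h3 : IsCoprime (3 ^ n) (X * Y) :=
    ((isCoprime_three hX₁ hX₂).mul_right (isCoprime_three hY₁ hY₂)).pow_left
  have hW3 : 3 ^ n ∣ W := h3.dvd_of_dvd_mul_left (hδe ▸ hδ)
  have hW' : ¬π₁ ^ (n + 1) ∣ W := fun h1 => hδ' (hδe ▸ h1.mul_left _)
  rcases n with - | m
  · exact absurd (by simpa using hW) hW'
  · exact ⟨m, rfl, X, Y, W, hXYW, hXY, hW3, hW'⟩

/-- The equation `X ^ 3 - Y ^ 3 = π₂ ^ 2 * Z ^ 3` has no primitive solution where `Z` has the same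
positive valuation at `π₁` as at `3`. -/
theorem sub_ne_of_three_pow_dvd (n : ℕ) : ¬∃ X Y Z : ZSqrtNegTwo,
    X ^ 3 - Y ^ 3 = π₂ ^ 2 * Z ^ 3 ∧ IsCoprime X Y ∧ 3 ^ (n + 1) ∣ Z ∧ ¬π₁ ^ (n + 2) ∣ Z := by
  induction n using Nat.strong_induction_on with
  | _ n ih =>
  rintro ⟨X, Y, Z, h, hXY, ⟨Z', rfl⟩, hZ⟩
  obtain ⟨g, h, δ, hgh, H, hδ, hν⟩ := descent_step (D := 3 ^ n * Z') (by rw [h]; ring) hXY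
  have h₁ : π₁ ∣ 3 := ⟨π₂, π₁_mul_π₂.symm⟩
  have hν₁ : ¬π₁ ∣ g ^ 2 - g * h + h ^ 2 := fun h1 =>
    prime_π₁.not_isUnit (hν.isUnit_of_dvd' h₁ h1)
  have hδ₁ : 3 ^ n ∣ δ := hν.pow_left.dvd_of_dvd_mul_right ⟨Z', hδ⟩
  have hδ₂ : ¬π₁ ^ (n + 1) ∣ δ := fun h1 => hZ (by
    have : 3 ^ (n + 1) * Z' = 3 * (δ * (g ^ 2 - g * h + h ^ 2)) := by rw [hδ]; ring
    rw [this, pow_succ' _ (n + 1)]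
    exact mul_dvd_mul h₁ (h1.mul_right _))
  have h₂ : π₂ ∣ g * h * (g - h) := H ▸ (dvd_pow_self _ two_ne_zero).mul_right _
  suffices ∃ m, n = m + 1 ∧ ∃ X Y Z, X ^ 3 - Y ^ 3 = π₂ ^ 2 * Z ^ 3 ∧ IsCoprime X Y ∧
      3 ^ (m + 1) ∣ Z ∧ ¬π₁ ^ (m + 2) ∣ Z by
    obtain ⟨m, rfl, h1⟩ := this
    exact ih m (Nat.lt_succ_self m) h1
  rcases prime_π₂.dvd_or_dvd h₂ with h₂ | h₂
  · rcases prime_π₂.dvd_or_dvd h₂ with h₂ | h₂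
    · refine descent_aux (δ := -δ) hgh.symm ?_ ?_ (hδ₁.neg_right) (by rwa [dvd_neg]) h₂
      · linear_combination -H
      · convert hν₁ using 2; ring
    · exact descent_aux hgh H hν₁ hδ₁ hδ₂ h₂
  · refine descent_aux (g := g) (h := g - h) (isCoprime_sub_right hgh) ?_ ?_ hδ₁ hδ₂ h₂
    · linear_combination H
    · convert hν₁ using 2; ring

theorem π₂_sq : π₂ ^ 2 = σ ^ 3 - 1 := by
  ext <;> simp [pow_succ]

theorem dvd_of_dvd_pow_three_sub {p a b : ZSqrtNegTwo} (hp : Prime p) (h3 : p ∣ 3)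
    (h : p ∣ a ^ 3 - b ^ 3) : p ∣ a - b :=
  hp.dvd_of_dvd_pow (n := 3) (by
    have : (a - b) ^ 3 = (a ^ 3 - b ^ 3) - 3 * ((a - b) * a * b) := by ring
    rw [this]
    exact dvd_sub h (h3.mul_right _))

/-- Solutions of `X ^ 3 - Y ^ 3 = π₂ ^ 2 * Z ^ 3` can be made primitive. -/
theorem exists_isCoprime_of_sub_eq {X Y Z : ZSqrtNegTwo} (h : X ^ 3 - Y ^ 3 = π₂ ^ 2 * Z ^ 3)
    (hX : X ≠ 0) : ∃ G x y z, G ≠ 0 ∧ X = G * x ∧ Z = G * z ∧ IsCoprime x y ∧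
      x ^ 3 - y ^ 3 = π₂ ^ 2 * z ^ 3 := by
  obtain ⟨a, b, hab⟩ := IsBezout.gcd_eq_sum X Y
  obtain ⟨x, hx⟩ := IsBezout.gcd_dvd_left X Y
  obtain ⟨y, hy⟩ := IsBezout.gcd_dvd_right X Y
  generalize IsBezout.gcd X Y = G at hab hx hy
  have hG : G ≠ 0 := by rintro rfl; simp [hx] at hX
  have h1 : π₂ ^ 2 * Z ^ 3 = G ^ 3 * (x ^ 3 - y ^ 3) := by rw [← h, hx, hy]; ring
  obtain ⟨t, ht⟩ : G ∣ π₂ * Z := by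
    rw [← IsIntegrallyClosed.pow_dvd_pow_iff three_ne_zero]
    exact ⟨π₂ * (x ^ 3 - y ^ 3), by linear_combination π₂ * h1⟩
  have h2 : t ^ 3 = π₂ * (x ^ 3 - y ^ 3) := by
    apply mul_left_cancel₀ (pow_ne_zero 3 hG)
    rw [← mul_pow, ← ht]
    linear_combination π₂ * h1
  obtain ⟨z, rfl⟩ : π₂ ∣ t := prime_π₂.dvd_of_dvd_pow (h2 ▸ dvd_mul_right _ _)
  refine ⟨G, x, y, z, hG, hx, mul_left_cancel₀ prime_π₂.ne_zero (by rw [ht]; ring),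
    ⟨a, b, ?_⟩, ?_⟩
  · apply mul_left_cancel₀ hG
    linear_combination hab - a * hx - b * hy
  · apply mul_left_cancel₀ prime_π₂.ne_zero
    rw [← h2]; ring

theorem mul_quadratic_eq_of_relation {a b c : ZSqrtNegTwo}
    (h : σ ^ 3 * b ^ 3 = a ^ 3 + (σ ^ 3 - 1) * c ^ 3) :
    σ ^ 3 * (σ * (a * b - c ^ 2)) * ((a * b) ^ 2 + a * b * c ^ 2 + c ^ 4) =
      σ * (a ^ 3 - c ^ 3) * (a ^ 3 + σ ^ 3 * c ^ 3) := by
  linear_combination σ * a ^ 3 * h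

theorem mul_quadratic_eq_mul_of_relation {a b c : ZSqrtNegTwo}
    (h : σ ^ 3 * b ^ 3 = a ^ 3 + (σ ^ 3 - 1) * c ^ 3) :
    (a * c + σ ^ 3 * b ^ 2) * ((a * c + σ ^ 3 * b ^ 2) ^ 2 - 3 * (a * c * (σ ^ 3 * b ^ 2))) =
      (a ^ 3 + σ ^ 3 * c ^ 3) * (σ ^ 3 * a ^ 3 + (σ ^ 3 - 1) ^ 2 * c ^ 3) := by
  linear_combination σ ^ 3 * (σ ^ 3 * b ^ 3 + a ^ 3 + (σ ^ 3 - 1) * c ^ 3) * h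

theorem relation_ne_of_three_pow {n : ℕ} {α α' β w : ZSqrtNegTwo}
    (h : σ ^ 3 * β ^ 3 = α ^ 3 + π₂ ^ 2 * α' ^ 3) (hα₁ : ¬π₁ ∣ α') (hα₂ : ¬π₂ ∣ α')
    (hαα : 3 ∣ α - α') (hw : α ^ 3 - α' ^ 3 = 3 ^ (n + 2) * w) (hw₁ : ¬π₁ ∣ w) : False := by
  have h₁ : π₁ ∣ 3 := ⟨π₂, π₁_mul_π₂.symm⟩
  have h₂ : π₂ ∣ 3 := ⟨π₁, by rw [mul_comm, π₁_mul_π₂]⟩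
  have hσ₁ : ¬π₁ ∣ σ := by rw [π₁_dvd_iff]; decide
  have hσ₂ : ¬π₂ ∣ σ := by rw [π₂_dvd_iff]; decide
  have hσ₁' : π₁ ∣ σ + 1 := by rw [π₁_dvd_iff]; decide
  have h3σ : IsCoprime 3 σ := isCoprime_three hσ₁ hσ₂
  have h3α : IsCoprime 3 α' := isCoprime_three hα₁ hα₂
  have hσσ := σ_sq
  rw [π₂_sq] at h
  have hβ : 3 ∣ β - α' := by
    have h3 : 3 ∣ β ^ 3 - α' ^ 3 := by
      refine (h3σ.pow_right (n := 3)).dvd_of_dvd_mul_left ?_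
      rw [show σ ^ 3 * (β ^ 3 - α' ^ 3) = α ^ 3 - α' ^ 3 by linear_combination h, hw]
      exact (dvd_pow_self _ (by simp)).mul_right _
    exact three_dvd (dvd_of_dvd_pow_three_sub prime_π₁ h₁ (h₁.trans h3))
      (dvd_of_dvd_pow_three_sub prime_π₂ h₂ (h₂.trans h3))
  obtain ⟨s, hs⟩ := hαα
  obtain ⟨t, ht⟩ := hβ
  obtain rfl : α = α' + 3 * s := by linear_combination hs
  obtain rfl : β = α' + 3 * t := by linear_combination ht
  set X := (α' + 3 * s) * α' + σ ^ 3 * (α' + 3 * t) ^ 2 with hXdef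
  set Y := (α' + 3 * s) ^ 2 + σ ^ 3 * (α' + 3 * t) * α' with hYdef
  set Z := σ * ((α' + 3 * s) * (α' + 3 * t) - α' ^ 2) with hZdef
  have hXYZ : X ^ 3 - Y ^ 3 = π₂ ^ 2 * Z ^ 3 := by
    rw [π₂_sq]
    linear_combination (σ ^ 6 * (α' + 3 * t) ^ 3 + 3 * (α' + 3 * s) * α' * σ ^ 3 * (α' + 3 * t)
      + (α' + 3 * s) ^ 3 - σ ^ 3 * α' ^ 3) * h
  obtain ⟨d, hd⟩ : ∃ d, (α' + 3 * s) * (α' + 3 * t) = α' ^ 2 + 3 * d :=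
    ⟨α' * t + s * α' + 3 * s * t, by ring⟩
  have hXe : X = (σ ^ 3 + 1) * α' ^ 2 + 3 * (s * α' + σ ^ 3 * (2 * α' * t + 3 * t ^ 2)) := by
    rw [hXdef]; ring
  obtain ⟨e, he⟩ : π₁ ∣ X := by
    rw [hXe]
    have : π₁ ∣ σ ^ 3 + 1 := by
      rw [show σ ^ 3 + 1 = (σ + 1) * (σ ^ 2 - σ + 1) by ring]
      exact hσ₁'.mul_right _
    exact dvd_add (this.mul_right _) (h₁.mul_right _)
  have hX0 : X ≠ 0 := by
    intro h0
    rw [hXe] at h0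
    have h2 : π₂ ∣ (σ ^ 3 + 1) * α' ^ 2 := by
      rw [eq_neg_of_add_eq_zero_left h0]
      exact (h₂.mul_right _).neg_right
    rcases prime_π₂.dvd_or_dvd h2 with h2 | h2
    · revert h2
      rw [π₂_dvd_iff]; decide
    · exact hα₂ (prime_π₂.dvd_of_dvd_pow h2)
  -- the cofactors of three multiples of `3`, `π₁` and `π₁` in the product identities
  let Q₁ := α' ^ 4 + 3 * (α' ^ 2 * d + d ^ 2)
  let Q₂ := π₁ * e ^ 2 - π₂ * ((α' + 3 * s) * α' * (σ ^ 3 * (α' + 3 * t) ^ 2))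
  let E := π₂ * (3 ^ (n + 1) * w * σ ^ 3) + (3 * σ - 1) * α' ^ 3
  have hmain : -2 * (Z * Q₁ * E) = 3 ^ (n + 1) * w * X * Q₂ := by
    have hq₁ := mul_quadratic_eq_of_relation h
    have hq₂ := mul_quadratic_eq_mul_of_relation h
    have e₁ : ((α' + 3 * s) * (α' + 3 * t)) ^ 2 + (α' + 3 * s) * (α' + 3 * t) * α' ^ 2 + α' ^ 4 =
        3 * Q₁ := by
      rw [hd]; simp only [Q₁]; ring
    have e₂ : X ^ 2 - 3 * ((α' + 3 * s) * α' * (σ ^ 3 * (α' + 3 * t) ^ 2)) = π₁ * Q₂ := by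
      linear_combination (X + π₁ * e) * he +
        ((α' + 3 * s) * α' * (σ ^ 3 * (α' + 3 * t) ^ 2)) * π₁_mul_π₂
    have e₃ : σ ^ 3 * (α' + 3 * s) ^ 3 + (σ ^ 3 - 1) ^ 2 * α' ^ 3 = π₁ * E := by
      have h1 : σ ^ 3 + (σ ^ 3 - 1) ^ 2 = π₁ * (3 * σ - 1) := by
        ext <;> simp [pow_succ]
      have h2 : σ ^ 3 * (3 ^ (n + 2) * w) = π₁ * (π₂ * (3 ^ (n + 1) * w * σ ^ 3)) := by
        rw [← mul_assoc π₁, π₁_mul_π₂]; ring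
      rw [← hw] at h2
      linear_combination h2 + α' ^ 3 * h1
    rw [← hZdef, e₁] at hq₁
    rw [← hXdef, e₂, e₃] at hq₂
    rw [hw] at hq₁
    have h3 : (3 : ZSqrtNegTwo) * σ * π₁ ≠ 0 := mul_ne_zero (mul_ne_zero
      (fun h => by simpa using congrArg re h) (fun h => by simpa using congrArg im h))
      prime_π₁.ne_zero
    apply mul_left_cancel₀ h3
    linear_combination π₁ * E * hq₁ - σ * (3 ^ (n + 2) * w) * hq₂ - 3 * σ * π₁ * Z * Q₁ * E * hσσ
  obtain ⟨G, x, y, z, hG, hx, hz, hxy, hxyz⟩ := exists_isCoprime_of_sub_eq hXYZ hX0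
  have hmain' : z * (2 * (Q₁ * E)) = 3 ^ (n + 1) * (-w * x * Q₂) := by
    apply mul_left_cancel₀ hG
    rw [hz, hx] at hmain
    linear_combination -hmain
  have hQ₁ : IsCoprime 3 Q₁ := (h3α.pow_right (n := 4)).add_mul_left_right _
  have hE : IsCoprime 3 E := by
    have h3 : 3 ∣ π₂ * (3 ^ (n + 1) * w * σ ^ 3) + 3 * σ * α' ^ 3 :=
      dvd_add ((((dvd_pow_self _ n.succ_ne_zero).mul_right _).mul_right _).mul_left _)
        ((dvd_mul_right _ _).mul_right _)
    obtain ⟨k, hk⟩ := h3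
    have := (h3α.pow_right (n := 3)).neg_right.add_mul_left_right k
    rwa [show -α' ^ 3 + 3 * k = E by rw [← hk]; simp only [E]; ring] at this
  have h32 : IsCoprime (3 : ZSqrtNegTwo) 2 := ⟨1, -1, by norm_num⟩
  have hz3 : 3 ^ (n + 1) ∣ z :=
    (h32.mul_right (hQ₁.mul_right hE)).pow_left.dvd_of_dvd_mul_right ⟨_, hmain'⟩
  refine sub_ne_of_three_pow_dvd n ⟨x, y, z, hxyz, hxy, hz3, fun hz1 => ?_⟩
  have hx₁ : ¬π₁ ∣ x := fun hx₁ => by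
    have hz₁ : π₁ ∣ z := (h₁.trans (dvd_pow_self _ n.succ_ne_zero)).trans hz3
    have hy₁ : π₁ ∣ y ^ 3 := by
      rw [show y ^ 3 = x ^ 3 - π₂ ^ 2 * z ^ 3 by rw [← hxyz]; ring]
      exact dvd_sub (dvd_pow hx₁ three_ne_zero) ((dvd_pow hz₁ three_ne_zero).mul_left _)
    exact prime_π₁.not_isUnit (hxy.isUnit_of_dvd' hx₁ (prime_π₁.dvd_of_dvd_pow hy₁))
  have hπ : ¬π₁ ∣ π₂ := by rw [π₁_dvd_iff]; decide
  have hQ₂ : ¬π₁ ∣ Q₂ := fun hd₁ => by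
    have hd₂ := (dvd_sub_right (dvd_mul_right _ _)).1 hd₁
    have h3s : ∀ r, ¬π₁ ∣ α' + 3 * r := fun r hr => hα₁ ((dvd_add_left (h₁.mul_right _)).1 hr)
    simp only [prime_π₁.dvd_mul, prime_π₁.dvd_pow_iff_dvd two_ne_zero,
      prime_π₁.dvd_pow_iff_dvd three_ne_zero, hπ, h3s, hα₁, hσ₁, or_self] at hd₂
  have h4 : π₁ ^ (n + 1) * π₁ ∣ π₁ ^ (n + 1) * (π₂ ^ (n + 1) * (-w * x * Q₂)) := by
    rw [← pow_succ, ← mul_assoc, ← mul_pow, π₁_mul_π₂, ← hmain']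
    exact hz1.mul_right _
  have h5 := (mul_dvd_mul_iff_left (pow_ne_zero _ prime_π₁.ne_zero)).1 h4
  simp only [neg_mul, mul_neg, dvd_neg, prime_π₁.dvd_mul, prime_π₁.dvd_pow_iff_dvd n.succ_ne_zero,
    hπ, hw₁, hx₁, hQ₂, or_self] at h5

theorem eq_zero_of_relation {p q : ℤ} {β : ZSqrtNegTwo} (hp : ¬3 ∣ p) (hq : 3 ∣ q)
    (h : σ ^ 3 * β ^ 3 = (⟨p, q⟩ : ZSqrtNegTwo) ^ 3 + π₂ ^ 2 * (⟨p, -q⟩ : ZSqrtNegTwo) ^ 3) :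
    q = 0 := by
  by_contra hq0
  obtain ⟨m, r, rfl, hr⟩ : ∃ m r, q = 3 ^ m * r ∧ ¬3 ∣ r :=
    ⟨_, (Int.finiteMultiplicity_iff.2 ⟨by decide, hq0⟩ :
      FiniteMultiplicity 3 q).exists_eq_pow_mul_and_not_dvd⟩
  obtain ⟨n, rfl⟩ : ∃ n, m = n + 1 := Nat.exists_eq_succ_of_ne_zero (by
    rintro rfl
    exact hr (by simpa using hq))
  have hw : ∀ b : ℤ, (⟨p, 3 * b⟩ : ZSqrtNegTwo) ^ 3 - (⟨p, -(3 * b)⟩ : ZSqrtNegTwo) ^ 3 =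
      ((9 * b : ℤ) : ZSqrtNegTwo) * ⟨0, 2 * p ^ 2 - 12 * b ^ 2⟩ := fun b => by
    ext <;> simp [pow_succ] <;> ring
  have h2p : ¬(3 : ℤ) ∣ 2 * p ^ 2 := fun h2 => by
    rcases Int.Prime.dvd_mul' Nat.prime_three h2 with h2 | h2
    · revert h2; decide
    · exact hp (Int.Prime.dvd_pow' Nat.prime_three h2)
  refine relation_ne_of_three_pow (n := n) (w := r * ⟨0, 2 * p ^ 2 - 12 * (3 ^ n * r) ^ 2⟩) h
    ?_ ?_ ?_ ?_ ?_
  · rw [π₁_dvd_iff]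
    intro hd
    exact hp ((dvd_sub_left (hq.neg_right)).1 hd)
  · rw [π₂_dvd_iff]
    intro hd
    exact hp ((dvd_add_left (hq.neg_right)).1 hd)
  · refine ⟨⟨0, 2 * (3 ^ n * r)⟩, ?_⟩
    rw [show (3 : ℤ) ^ (n + 1) * r = 3 * (3 ^ n * r) by ring]
    ext <;> simp
    ring
  · rw [show (3 : ℤ) ^ (n + 1) * r = 3 * (3 ^ n * r) by ring, hw]
    push_cast
    ring
  · rw [prime_π₁.dvd_mul, not_or]
    constructor
    · rw [π₁_dvd_iff]
      simpa
    · rw [π₁_dvd_iff]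
      intro hd
      refine h2p ?_
      have : (2 : ℤ) * p ^ 2 = 3 * (4 * (3 ^ n * r) ^ 2) -
        ((0 : ℤ) - (2 * p ^ 2 - 12 * (3 ^ n * r) ^ 2)) * 1 := by ring
      rw [this]
      exact dvd_sub (dvd_mul_right _ _) (hd.mul_right _)

theorem exists_eq_π₁_mul_pow_three {u v a : ℤ} (huv : IsCoprime u v) (hv : Odd v)
    (h3 : 3 ∣ v - u) (h : v ^ 2 + 2 * u ^ 2 = 3 * a ^ 3) :
    ∃ α : ZSqrtNegTwo, ⟨v, u⟩ = π₁ * α ^ 3 := by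
  obtain ⟨μ, hμ⟩ := (π₁_dvd_iff (z := ⟨v, u⟩)).2 h3
  have hstar : (⟨v, -u⟩ : ZSqrtNegTwo) = π₂ * star μ := by
    have := congrArg star hμ
    rw [star_mul] at this
    rw [mul_comm]
    simpa [star] using this
  have hμμ : μ * star μ = (a : ZSqrtNegTwo) ^ 3 := by
    apply mul_left_cancel₀ (mul_ne_zero prime_π₁.ne_zero prime_π₂.ne_zero)
    have : (⟨v, u⟩ : ZSqrtNegTwo) * ⟨v, -u⟩ = ((v ^ 2 + 2 * u ^ 2 : ℤ) : ZSqrtNegTwo) := by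
      ext <;> simp [pow_succ] <;> ring
    rw [h] at this
    rw [π₁_mul_π₂, ← mul_assoc]
    push_cast at this
    rw [← this, hμ, hstar, ← π₁_mul_π₂]; ring
  have ha : IsCoprime a 2 := by
    have ha' : Odd (3 * a ^ 3) := h ▸ hv.pow.add_even (even_two_mul _)
    obtain ⟨k, hk⟩ := (Int.odd_pow' three_ne_zero).1 (Int.odd_mul.1 ha').2
    exact ⟨1, -k, by rw [hk]; ring⟩
  have hcop : IsCoprime μ (star μ) := by
    have h2a : IsCoprime ((a : ZSqrtNegTwo) ^ 3) (2 * σ) := by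
      have h1 : IsCoprime (a : ZSqrtNegTwo) 2 := by
        simpa using ha.map (Int.castRingHom ZSqrtNegTwo)
      have h2 : IsCoprime (a : ZSqrtNegTwo) σ :=
        h1.of_isCoprime_of_dvd_right ⟨-σ, by linear_combination σ_sq⟩
      exact (h1.mul_right h2).pow_left
    obtain ⟨s, t, hst⟩ := huv
    have hst' : (s * u + t * v : ZSqrtNegTwo) = 1 := by
      simpa using congrArg (Int.cast : ℤ → ZSqrtNegTwo) hst
    obtain ⟨b, c, hbc⟩ := h2a
    have e1 : (⟨v, u⟩ : ZSqrtNegTwo) = v + u * σ := by ext <;> simp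
    have e2 : (⟨v, -u⟩ : ZSqrtNegTwo) = v - u * σ := by ext <;> simp
    rw [e1] at hμ
    rw [e2] at hstar
    rw [← hμμ] at hbc
    refine ⟨b * star μ + c * (s + t * σ) * π₁, c * (t * σ - s) * π₂, ?_⟩
    linear_combination hbc - c * (s + t * σ) * hμ - c * (t * σ - s) * hstar + 2 * c * σ * hst'
  obtain ⟨α, hα⟩ := exists_eq_pow_three hcop hμμ
  exact ⟨α, by rw [hμ, hα]⟩

theorem not_dvd_and_dvd_of_eq {p q r s : ℤ}
    (h₁ : r ^ 3 - 6 * r * s ^ 2 = p ^ 3 - 6 * p * q ^ 2 - (3 * p ^ 2 * q - 2 * q ^ 3))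
    (h₂ : 3 * r ^ 2 * s - 2 * s ^ 3 = -(3 * p ^ 2 * q - 2 * q ^ 3))
    (h₃ : ¬3 ∣ p ^ 3 - 6 * p * q ^ 2 + (3 * p ^ 2 * q - 2 * q ^ 3)) : ¬3 ∣ p ∧ 3 ∣ q := by
  have mod₁ : ∀ p q r s : ZMod 3,
      r ^ 3 - 6 * r * s ^ 2 = p ^ 3 - 6 * p * q ^ 2 - (3 * p ^ 2 * q - 2 * q ^ 3) →
      3 * r ^ 2 * s - 2 * s ^ 3 = -(3 * p ^ 2 * q - 2 * q ^ 3) → s + q = 0 ∧ r - (p - q) = 0 := by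
    decide
  have mod₂ : ∀ p q : ZMod 3, q ^ 2 * (2 * p - q) = 0 →
      ¬p ^ 3 - 6 * p * q ^ 2 + (3 * p ^ 2 * q - 2 * q ^ 3) = 0 → ¬p = 0 ∧ q = 0 := by
    decide
  have hdvd : ∀ n : ℤ, 3 ∣ n ↔ (n : ZMod 3) = 0 := fun n =>
    (ZMod.intCast_zmod_eq_zero_iff_dvd n 3).symm
  obtain ⟨hs, hr⟩ := mod₁ p q r s (by exact_mod_cast congrArg (Int.cast : ℤ → ZMod 3) h₁)
    (by exact_mod_cast congrArg (Int.cast : ℤ → ZMod 3) h₂)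
  obtain ⟨k, hk⟩ := (hdvd (s + q)).2 (by exact_mod_cast hs)
  obtain ⟨l, hl⟩ := (hdvd (r - (p - q))).2 (by exact_mod_cast hr)
  obtain rfl : s = -q + 3 * k := by linarith
  obtain rfl : r = p - q + 3 * l := by linarith
  have h₄ : 3 ∣ q ^ 2 * (2 * p - q) := by
    refine ⟨q * (2 * l * (p - q) + 3 * l ^ 2) - ((p - q + 3 * l) ^ 2 * k - 2 * q ^ 2 * k +
      6 * q * k ^ 2 - 6 * k ^ 3), ?_⟩
    linarith
  rw [hdvd] at h₃ h₄
  simp only [hdvd]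
  exact mod₂ p q (by exact_mod_cast h₄) (by exact_mod_cast h₃)

theorem eq_of_sq_add_two_mul_sq {a b u v : ℤ} (huv : IsCoprime u v) (hu : Odd u) (hv : Odd v)
    (hu3 : ¬3 ∣ u) (h3 : 3 ∣ v - u)
    (ha : v ^ 2 + 2 * u ^ 2 = 3 * a ^ 3) (hb : u ^ 2 + 2 * v ^ 2 = 3 * b ^ 3) : a = b := by
  obtain ⟨⟨p, q⟩, hα⟩ := exists_eq_π₁_mul_pow_three huv hv h3 ha
  obtain ⟨⟨r, s⟩, hβ⟩ := exists_eq_π₁_mul_pow_three huv.symm hu (by rwa [dvd_sub_comm]) hb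
  have a1 := congrArg re hα
  have a2 := congrArg im hα
  have b1 := congrArg re hβ
  have b2 := congrArg im hβ
  simp [pow_succ] at a1 a2 b1 b2
  obtain ⟨hp, hq⟩ := not_dvd_and_dvd_of_eq (p := p) (q := q) (r := r) (s := s)
    (by linarith) (by linarith)
    (by rwa [show p ^ 3 - 6 * p * q ^ 2 + (3 * p ^ 2 * q - 2 * q ^ 3) = u by linarith])
  have hq0 : q = 0 := eq_zero_of_relation (p := p) (q := q) (β := ⟨r, s⟩) hp hq (by
    ext <;> simp [pow_succ] <;> linarith)
  subst hq0
  have : a ^ 3 = b ^ 3 := by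
    have : u = v := by linarith
    subst this
    linarith
  exact (Odd.strictMono_pow (by decide : Odd 3)).injective this

end ZSqrtNegTwo

theorem IsCoprime.of_two_mul_add {a b S T : ℤ} (hab : IsCoprime a b) (h₁ : 2 * S + T = 3 * a ^ 3)
    (h₂ : S + 2 * T = 3 * b ^ 3) (hS : ¬3 ∣ S) : IsCoprime S T := by
  refine isCoprime_of_prime_dvd (fun h => hS (h.1 ▸ dvd_zero 3)) fun p hp hpS hpT => ?_
  have hp3 : ¬p ∣ 3 := fun h => hS ((hp.associated_of_dvd Int.prime_three h).dvd'.trans hpS)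
  have ha : p ∣ a := hp.dvd_of_dvd_pow ((hp.dvd_or_dvd
    (h₁ ▸ dvd_add (hpS.mul_left 2) hpT)).resolve_left hp3)
  have hb : p ∣ b := hp.dvd_of_dvd_pow ((hp.dvd_or_dvd
    (h₂ ▸ dvd_add hpS (hpT.mul_left 2))).resolve_left hp3)
  exact hp.not_isUnit (hab.isUnit_of_dvd' ha hb)

theorem odd_of_two_mul_pow_sub_eq {a b u : ℤ} (hab : IsCoprime a b)
    (hu : 2 * a ^ 3 - b ^ 3 = u ^ 2) : Odd u := by
  by_contra h
  obtain ⟨k, rfl⟩ := even_iff_two_dvd.1 (Int.not_odd_iff_even.1 h)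
  have hb : 2 ∣ b := Int.prime_two.dvd_of_dvd_pow (n := 3) ⟨a ^ 3 - 2 * k ^ 2, by linarith⟩
  obtain ⟨c, rfl⟩ := hb
  have ha : 2 ∣ a := Int.prime_two.dvd_of_dvd_pow (n := 3) ⟨k ^ 2 + 2 * c ^ 3, by linarith⟩
  exact Int.prime_two.not_isUnit (hab.isUnit_of_dvd' ha (dvd_mul_right _ _))

theorem eq_of_two_mul_pow_sub_eq_sq {a b u v : ℤ} (hab : IsCoprime a b)
    (hu : 2 * a ^ 3 - b ^ 3 = u ^ 2) (hv : 2 * b ^ 3 - a ^ 3 = v ^ 2) : a = b := by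
  have h3 := Int.prime_three
  have ha : v ^ 2 + 2 * u ^ 2 = 3 * a ^ 3 := by linarith
  have hb : u ^ 2 + 2 * v ^ 2 = 3 * b ^ 3 := by linarith
  have hu3 : ¬3 ∣ u := by
    rintro ⟨k, rfl⟩
    obtain ⟨l, rfl⟩ : 3 ∣ v := h3.dvd_of_dvd_pow (n := 2) ⟨a ^ 3 - 6 * k ^ 2, by linarith⟩
    have ha' : 3 ∣ a := h3.dvd_of_dvd_pow (n := 3) ⟨l ^ 2 + 2 * k ^ 2, by linarith⟩
    have hb' : 3 ∣ b := h3.dvd_of_dvd_pow (n := 3) ⟨k ^ 2 + 2 * l ^ 2, by linarith⟩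
    exact h3.not_isUnit (hab.isUnit_of_dvd' ha' hb')
  have huv : IsCoprime u v := by
    have := hab.of_two_mul_add (S := u ^ 2) (T := v ^ 2) (by linarith) (by linarith)
      (fun h => hu3 (h3.dvd_of_dvd_pow h))
    exact (IsCoprime.pow_iff two_pos two_pos).1 this
  have huo := odd_of_two_mul_pow_sub_eq hab hu
  have hvo := odd_of_two_mul_pow_sub_eq hab.symm hv
  have hdvd : 3 ∣ (v - u) * (v - -u) := ⟨a ^ 3 - u ^ 2, by linarith⟩
  rcases h3.dvd_or_dvd hdvd with h | h
  · exact ZSqrtNegTwo.eq_of_sq_add_two_mul_sq huv huo hvo hu3 h ha hb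
  · exact ZSqrtNegTwo.eq_of_sq_add_two_mul_sq huv.neg_left huo.neg hvo (by rwa [dvd_neg]) h
      (by rwa [neg_sq]) (by rwa [neg_sq])

theorem not_three_dvd_of_sq_eq {a b w : ℤ} (hab : IsCoprime a b)
    (h : w ^ 2 = (2 * a ^ 3 - b ^ 3) * (2 * b ^ 3 - a ^ 3)) : ¬3 ∣ 2 * a ^ 3 - b ^ 3 := by
  intro h3
  have hdvd : ∀ n : ℤ, 3 ∣ n ↔ (n : ZMod 3) = 0 := fun n =>
    (ZMod.intCast_zmod_eq_zero_iff_dvd n 3).symm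
  obtain ⟨j, hj⟩ : 3 ∣ a + b := by
    have : ∀ a b : ZMod 3, 2 * a ^ 3 - b ^ 3 = 0 → a + b = 0 := by decide
    rw [hdvd] at h3 ⊢
    push_cast at h3 ⊢
    exact this a b h3
  obtain rfl : b = -a + 3 * j := by linarith
  obtain ⟨k, rfl⟩ : 3 ∣ w := Int.prime_three.dvd_of_dvd_pow (n := 2) (h ▸ h3.mul_right _)
  have hk : 3 ∣ k ^ 2 + a ^ 6 := by
    refine ⟨(a ^ 3) * (2 * a ^ 2 * j - 6 * a * j ^ 2 + 6 * j ^ 3) +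
      (a ^ 2 * j - 3 * a * j ^ 2 + 3 * j ^ 3) *
        (a ^ 3 - 6 * a ^ 2 * j + 18 * a * j ^ 2 - 18 * j ^ 3),
      ?_⟩
    linarith
  have ha : 3 ∣ a := by
    have : ∀ k a : ZMod 3, k ^ 2 + a ^ 6 = 0 → a = 0 := by decide
    rw [hdvd] at hk ⊢
    push_cast at hk
    exact this k a hk
  exact Int.prime_three.not_isUnit
    (hab.isUnit_of_dvd' ha (dvd_add ha.neg_right (dvd_mul_right _ _)))

theorem sq_ne_mul_of_opposite_signs {w S T u v : ℤ} (hS : S ≠ 0) (hT : T ≠ 0)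
    (hu : S = u ^ 2) (hv : T = -v ^ 2) : w ^ 2 ≠ S * T := by
  have hS' : 0 < S := lt_of_le_of_ne (hu ▸ sq_nonneg u) hS.symm
  have hT' : T < 0 := lt_of_le_of_ne (hv ▸ neg_nonpos.2 (sq_nonneg v)) hT
  exact fun h => absurd (sq_nonneg w) (not_le.2 (h ▸ mul_neg_of_pos_of_neg hS' hT'))

theorem eq_of_sq_eq {a b w : ℤ} (hab : IsCoprime a b)
    (h : w ^ 2 = (2 * a ^ 3 - b ^ 3) * (2 * b ^ 3 - a ^ 3)) : a = b := by
  have h3 := not_three_dvd_of_sq_eq hab h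
  have h3' := not_three_dvd_of_sq_eq hab.symm (by rw [h, mul_comm])
  have hST : IsCoprime (2 * a ^ 3 - b ^ 3) (2 * b ^ 3 - a ^ 3) :=
    hab.of_two_mul_add (by ring) (by ring) h3
  have hS : 2 * a ^ 3 - b ^ 3 ≠ 0 := fun h0 => h3 (h0 ▸ dvd_zero 3)
  have hT : 2 * b ^ 3 - a ^ 3 ≠ 0 := fun h0 => h3' (h0 ▸ dvd_zero 3)
  obtain ⟨u, hu⟩ := Int.sq_of_isCoprime hST h.symm
  obtain ⟨v, hv⟩ := Int.sq_of_isCoprime hST.symm (c := w) (by rw [h, mul_comm])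
  rcases hu with hu | hu <;> rcases hv with hv | hv
  · exact eq_of_two_mul_pow_sub_eq_sq hab hu hv
  · exact absurd h (sq_ne_mul_of_opposite_signs hS hT hu hv)
  · exact absurd (h.trans (mul_comm _ _)) (sq_ne_mul_of_opposite_signs hT hS hv hu)
  · exact neg_injective (eq_of_two_mul_pow_sub_eq_sq hab.neg_neg (u := u) (v := v)
      (by linarith) (by linarith))

/-- The only affine rational points of the curve `y² = -2x⁶ + 5x³ - 2` are
`(x, y) = (1, 1)` and `(1, -1)`. -/
theorem rational_points_neg_two_x6 (x y : ℚ)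
    (h : y ^ 2 = -2 * x ^ 6 + 5 * x ^ 3 - 2) :
    (x = 1 ∧ y = 1) ∨ (x = 1 ∧ y = -1) := by
  have hint : IsSquare (((2 * x.num ^ 3 - x.den ^ 3) * (2 * x.den ^ 3 - x.num ^ 3) : ℤ) : ℚ) := by
    refine ⟨y * x.den ^ 3, ?_⟩
    have hx : (x.num : ℚ) = x * x.den := (Rat.mul_den_eq_num x).symm
    push_cast
    rw [hx]
    linear_combination -(x.den : ℚ) ^ 6 * h
  obtain ⟨w, hw⟩ := Rat.isSquare_intCast_iff.1 hint
  have hx := eq_of_sq_eq x.isCoprime_num_den (w := w) (by rw [hw, sq])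
  have hx1 : x = 1 := by
    rw [← Rat.num_div_den x, hx]
    simp
  subst hx1
  have : y ^ 2 = 1 := by rw [h]; norm_num
  rcases sq_eq_one_iff.1 this with h1 | h1 <;> simp [h1]
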